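/- (Proposition 2 (1), concretized.) Let c ∈ ℝ², r > 0, and let p ∈ S(c,r) satisfy (p − c)₁ ≠ 0 and (p − c)₂ ≠ 0, i.e., p is neither a vertical pole nor a horizontal pole of S(c,r). Then there exists ε > 0 such that for all distinct points p₁, p₂ ∈ S(c,r) with ‖p₁ − p‖ < ε and ‖p₂ − p‖ < ε, both coordinates of p₂ − p₁ are nonzero and ((p₂ − p₁)₁ · (p₂ − p₁)₂) · ((p − c)₁ · (p − c)₂) < 0. In particular, the two coordinates of any such short chord vector have the same sign when (p − c)₁ · (p − c)₂ < 0 and opposite signs when (p − c)₁ · (p − c)₂ > 0, and which alternative occurs depends only on p. -/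

import Mathlib

/-- A real number closer to `a` than `|a|` has the same sign as `a`. -/
theorem mul_pos_of_abs_sub_lt_abs {x a : ℝ} (h : |x - a| < |a|) : 0 < x * a := by
  nlinarith [sq_lt_sq.mpr h, sq_nonneg x]

/-- If `(d, e)` is a nonzero vector orthogonal to `(s, t)`, and `s`, `t` have the same signs as
`a`, `b` respectively, then `d * e` and `a * b` have opposite signs. -/
theorem mul_mul_mul_neg_of_orthogonal {d e s t a b : ℝ} (horth : d * s + e * t = 0)
    (hs : 0 < s * a) (ht : 0 < t * b) (hne : d ≠ 0 ∨ e ≠ 0) :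
    d ≠ 0 ∧ e ≠ 0 ∧ (d * e) * (a * b) < 0 := by
  have hs0 : s ≠ 0 := left_ne_zero_of_mul hs.ne'
  have ht0 : t ≠ 0 := left_ne_zero_of_mul ht.ne'
  have ha0 : a ≠ 0 := right_ne_zero_of_mul hs.ne'
  have hb0 : b ≠ 0 := right_ne_zero_of_mul ht.ne'
  have hd : d ≠ 0 := by
    rintro rfl
    simp_all
  have he : e ≠ 0 := by
    rintro rfl
    simp_all
  refine ⟨hd, he, ?_⟩
  have key : (d * e) * (a * b) * ((s * a) * (t * b)) = -(e * t * (a * b)) ^ 2 := by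
    linear_combination e * t * (a * b) ^ 2 * horth
  have hpos : 0 < (e * t * (a * b)) ^ 2 := by positivity
  exact neg_of_mul_neg_left (by linarith) (mul_pos hs ht).le

/-- A point closer to `p` than `|(p - c) i|` lies strictly on the same side of `c` as `p`
in the `i`-th coordinate. -/
theorem EuclideanSpace.mul_coord_pos_of_norm_sub_lt {ι : Type*} [Fintype ι]
    {c p q : EuclideanSpace ℝ ι} {i : ι} (h : ‖q - p‖ < |(p - c) i|) :
    0 < (q - c) i * (p - c) i := by
  apply mul_pos_of_abs_sub_lt_abs
  have hle := PiLp.norm_apply_le (q - p) i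
  rw [Real.norm_eq_abs] at hle
  have heq : (q - c) i - (p - c) i = (q - p) i := by simp
  rw [heq]
  exact hle.trans_lt h

/-- Proposition 2 (1), concretized. If `p` on the circle `Metric.sphere c r` is neither a
vertical nor a horizontal pole (both coordinates of `p - c` are nonzero), then all
sufficiently short chords near `p` have both coordinates of their direction nonzero, and
the product of the two coordinates of the chord direction has sign opposite to the sign of
`(p - c) 0 * (p - c) 1`; in particular which sign alternative occurs depends only on `p`. -/
theorem short_chord_signs_away_from_poles (c p : EuclideanSpace ℝ (Fin 2)) (r : ℝ) (hr : 0 < r)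
    (hp : p ∈ Metric.sphere c r) (h1 : (p - c) 0 ≠ 0) (h2 : (p - c) 1 ≠ 0) :
    ∃ ε > 0, ∀ p₁ p₂ : EuclideanSpace ℝ (Fin 2),
      p₁ ∈ Metric.sphere c r → p₂ ∈ Metric.sphere c r → p₁ ≠ p₂ →
      ‖p₁ - p‖ < ε → ‖p₂ - p‖ < ε →
      (p₂ - p₁) 0 ≠ 0 ∧ (p₂ - p₁) 1 ≠ 0 ∧
        ((p₂ - p₁) 0 * (p₂ - p₁) 1) * ((p - c) 0 * (p - c) 1) < 0 := by
  refine ⟨min |(p - c) 0| |(p - c) 1|, lt_min (abs_pos.mpr h1) (abs_pos.mpr h2), ?_⟩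
  intro p₁ p₂ hp₁ hp₂ hne hd₁ hd₂
  rw [lt_min_iff] at hd₁ hd₂
  have hs₁ := EuclideanSpace.mul_coord_pos_of_norm_sub_lt hd₁.1
  have hs₂ := EuclideanSpace.mul_coord_pos_of_norm_sub_lt hd₂.1
  have ht₁ := EuclideanSpace.mul_coord_pos_of_norm_sub_lt hd₁.2
  have ht₂ := EuclideanSpace.mul_coord_pos_of_norm_sub_lt hd₂.2
  rw [mem_sphere_iff_norm] at hp₁ hp₂
  have hsq₁ := EuclideanSpace.real_norm_sq_eq (p₁ - c)
  have hsq₂ := EuclideanSpace.real_norm_sq_eq (p₂ - c)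
  rw [hp₁, Fin.sum_univ_two] at hsq₁
  rw [hp₂, Fin.sum_univ_two] at hsq₂
  refine mul_mul_mul_neg_of_orthogonal (s := (p₁ - c) 0 + (p₂ - c) 0)
    (t := (p₁ - c) 1 + (p₂ - c) 1) ?_ (by linarith) (by linarith) ?_
  · simp only [PiLp.sub_apply] at hsq₁ hsq₂ ⊢
    linear_combination hsq₁ - hsq₂
  · by_contra! h
    refine hne (sub_eq_zero.mp ?_).symm
    ext i
    fin_cases i
    · exact h.1
    · exact h.2
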